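/- Under the a priori hypotheses, there exists C₂ > 0 depending only on T, C_f and C₁ (where C₁ is the uniform bound on |u|, depending only on Ω, T, C_u, C_φ, C_f) such that t·|∂u/∂t| ≤ C₂ on Ω×(0,T). -/

import Mathlib

open Set Metric Complex Topology Filter Bornology
open scoped ComplexOrder

noncomputable section

/-- `ℂⁿ` with its Euclidean structure. -/
abbrev Cn (n : ℕ) := EuclideanSpace ℂ (Fin n)

/-- The `α`-th coordinate vector scaled by `c`. -/
def cvec (n : ℕ) (α : Fin n) (c : ℂ) : Cn n := EuclideanSpace.single α c

variable {n : ℕ}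

/-- Wirtinger derivative `∂/∂z_α` (within a set), via the real Fréchet derivative. -/
def wderW (s : Set (Cn n)) (α : Fin n) (u : Cn n → ℂ) (z : Cn n) : ℂ :=
  (fderivWithin ℝ u s z (cvec n α 1) - Complex.I * fderivWithin ℝ u s z (cvec n α Complex.I)) / 2

/-- Conjugate Wirtinger derivative `∂/∂z̄_β` (within a set). -/
def wderBarW (s : Set (Cn n)) (β : Fin n) (u : Cn n → ℂ) (z : Cn n) : ℂ :=
  (fderivWithin ℝ u s z (cvec n β 1) + Complex.I * fderivWithin ℝ u s z (cvec n β Complex.I)) / 2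

/-- The complex Hessian matrix `u_{αβ̄} = ∂²u/∂z_α ∂z̄_β` of a real valued function,
computed within a set `s`. -/
def cHessW (s : Set (Cn n)) (u : Cn n → ℝ) (z : Cn n) : Matrix (Fin n) (Fin n) ℂ :=
  Matrix.of fun α β => wderW s α (wderBarW s β fun w => (u w : ℂ)) z

/-- The complex Hessian matrix `u_{αβ̄}`. -/
def cHess (u : Cn n → ℝ) : Cn n → Matrix (Fin n) (Fin n) ℂ := cHessW univ u

/-- The Euclidean Laplacian (within a set) of `v : ℂⁿ → ℝ`, i.e. the sum of all pure second
derivatives in the `2n` underlying real coordinate directions. -/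
def lapW (s : Set (Cn n)) (v : Cn n → ℝ) (z : Cn n) : ℝ :=
  ∑ α : Fin n,
    (fderivWithin ℝ (fun y => fderivWithin ℝ v s y (cvec n α 1)) s z (cvec n α 1) +
      fderivWithin ℝ (fun y => fderivWithin ℝ v s y (cvec n α Complex.I)) s z
        (cvec n α Complex.I))

/-- The Euclidean Laplacian of `v : ℂⁿ → ℝ`. -/
def lap (v : Cn n → ℝ) : Cn n → ℝ := lapW univ v

/-- A bounded smooth strictly pseudoconvex domain of `ℂⁿ`: a bounded (nonempty) domain with a
smooth strictly plurisubharmonic defining function `ρ` on a bounded neighbourhood of its closure,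
with nonvanishing differential on the boundary. -/
def IsSPCDomain (Ω : Set (Cn n)) : Prop :=
  IsOpen Ω ∧ Ω.Nonempty ∧ IsBounded Ω ∧
    ∃ (U : Set (Cn n)) (ρ : Cn n → ℝ), IsOpen U ∧ IsBounded U ∧ closure Ω ⊆ U ∧
      ContDiffOn ℝ (⊤ : ℕ∞) ρ U ∧ (∀ z ∈ U, (cHess ρ z).PosDef) ∧
      Ω = {z ∈ U | ρ z < 0} ∧ ∀ z ∈ frontier Ω, fderiv ℝ ρ z ≠ 0

/-- Membership in `C^{2;1}(Ω̄ × [0,T))`: `u(·,t) ∈ C²(Ω̄)` for each `t ∈ [0,T)`,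
`u(z,·) ∈ C¹([0,T))` for each `z ∈ Ω̄`, and `∂u/∂t` together with all second spatial
derivatives are continuous on `Ω̄ × [0,T)`. -/
def C21 (n : ℕ) (Ω : Set (Cn n)) (T : ℝ) (u : Cn n × ℝ → ℝ) : Prop :=
  (∀ t ∈ Ico (0 : ℝ) T, ContDiffOn ℝ 2 (fun z => u (z, t)) (closure Ω)) ∧
  (∀ z ∈ closure Ω, ContDiffOn ℝ 1 (fun s => u (z, s)) (Ico (0 : ℝ) T)) ∧
  ContinuousOn (fun p : Cn n × ℝ => derivWithin (fun s => u (p.1, s)) (Ico (0 : ℝ) T) p.2)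
    (closure Ω ×ˢ Ico (0 : ℝ) T) ∧
  ∀ v w : Cn n, ContinuousOn
    (fun p : Cn n × ℝ =>
      fderivWithin ℝ (fun y => fderivWithin ℝ (fun x => u (x, p.2)) (closure Ω) y v)
        (closure Ω) p.1 w)
    (closure Ω ×ˢ Ico (0 : ℝ) T)

/-- The hypotheses of the a priori estimates theorem: `φ ∈ C^∞(Ω̄×[0,T))`,
`f ∈ C^∞([0,T)×Ω̄×ℝ)`, `u ∈ C^∞(Ω×(0,T)) ∩ C^{2;1}(Ω̄×[0,T))` is strictly plurisubharmonic
in `z` and solves `∂u/∂t = log det(u_{αβ̄}) + f(t,z,u)` on `Ω×(0,T)` with `u = φ` on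
`∂Ω×[0,T)`, `sup_Ω |u(·,0)| ≤ Cu`, `f` nonincreasing in the last variable,
`‖f‖_{C²((0,T)×Ω×ℝ)} ≤ Cf` and `‖φ‖_{C⁴(Ω×(0,T))} ≤ Cφv` (parabolic norm). -/
def AprioriHyps (n : ℕ) (Ω : Set (Cn n)) (T Cu Cφv Cf : ℝ)
    (u φ : Cn n × ℝ → ℝ) (f : ℝ × Cn n × ℝ → ℝ) : Prop :=
  ContDiffOn ℝ (⊤ : ℕ∞) φ (closure Ω ×ˢ Ico (0 : ℝ) T) ∧
  ContDiffOn ℝ (⊤ : ℕ∞) f (Ico (0 : ℝ) T ×ˢ closure Ω ×ˢ (univ : Set ℝ)) ∧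
  ContDiffOn ℝ (⊤ : ℕ∞) u (Ω ×ˢ Ioo (0 : ℝ) T) ∧
  C21 n Ω T u ∧
  (∀ t ∈ Ioo (0 : ℝ) T, ∀ z ∈ Ω, (cHess (fun w => u (w, t)) z).PosDef) ∧
  (∀ z ∈ Ω, ∀ t ∈ Ioo (0 : ℝ) T,
    deriv (fun s => u (z, s)) t
      = Real.log ((cHess (fun w => u (w, t)) z).det.re) + f (t, z, u (z, t))) ∧
  (∀ z ∈ frontier Ω, ∀ t ∈ Ico (0 : ℝ) T, u (z, t) = φ (z, t)) ∧
  (∀ z ∈ Ω, |u (z, 0)| ≤ Cu) ∧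
  (∀ t ∈ Ioo (0 : ℝ) T, ∀ z ∈ Ω, ∀ r : ℝ, deriv (fun y => f (t, z, y)) r ≤ 0) ∧
  (∀ k : ℕ, k ≤ 2 → ∀ p ∈ Ioo (0 : ℝ) T ×ˢ Ω ×ˢ (univ : Set ℝ),
    ‖iteratedFDeriv ℝ k f p‖ ≤ Cf) ∧
  (∀ j l : ℕ, j + 2 * l ≤ 4 → ∀ z ∈ Ω, ∀ t ∈ Ioo (0 : ℝ) T,
    ‖iteratedFDeriv ℝ j (fun w => iteratedDeriv l (fun s => φ (w, s)) t) z‖ ≤ Cφv)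


/-! ### Linear algebra -/

theorem aux_one_le_det {P : Matrix (Fin n) (Fin n) ℂ} (hP : P.PosSemidef) :
    1 ≤ ((1 + P).det).re := by
  have hH := hP.1
  have h1 : (1 + P).det = ∏ i, ((1 + hH.eigenvalues i : ℝ) : ℂ) := by
    have h2 := hH.spectral_theorem
    have h3 : (1 + P) = Unitary.conjStarAlgAut ℂ _ hH.eigenvectorUnitary
        (1 + Matrix.diagonal (RCLike.ofReal ∘ hH.eigenvalues)) := by
      rw [map_add, map_one, ← h2]
    rw [h3, Unitary.conjStarAlgAut_apply, Matrix.det_mul_comm, ← mul_assoc]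
    simp only [Unitary.coe_star_mul_self, one_mul]
    rw [← Matrix.diagonal_one, Matrix.diagonal_add, Matrix.det_diagonal]
    simp
  rw [h1, ← Complex.ofReal_prod, Complex.ofReal_re]
  calc (1 : ℝ) = ∏ i : Fin n, (1 : ℝ) := by simp
    _ ≤ _ := Finset.prod_le_prod (by simp) (fun i _ => by linarith [hP.eigenvalues_nonneg i])

open scoped MatrixOrder Matrix.Norms.L2Operator in
theorem aux_exists_factor {B : Matrix (Fin n) (Fin n) ℂ} (hB : B.PosDef) :
    ∃ y : Matrix (Fin n) (Fin n) ℂ, IsUnit y ∧ B = star y * y :=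
  CStarAlgebra.isStrictlyPositive_iff_eq_star_mul_self.mp hB.isStrictlyPositive

theorem aux_det_mono {A B : Matrix (Fin n) (Fin n) ℂ} (hB : B.PosDef)
    (h : (A - B).PosSemidef) : B.det.re ≤ A.det.re := by
  obtain ⟨y, hy, hBy⟩ := aux_exists_factor hB
  have hyd : IsUnit y.det := (Matrix.isUnit_iff_isUnit_det y).1 hy
  have hP := h.conjTranspose_mul_mul_same y⁻¹
  set P := (y⁻¹).conjTranspose * (A - B) * y⁻¹ with hPdef
  have hA : A = star y * (1 + P) * y := by
    have e1 : y⁻¹ * y = 1 := Matrix.nonsing_inv_mul y hyd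
    have e2 : star y * (y⁻¹).conjTranspose = 1 := by
      rw [Matrix.star_eq_conjTranspose, ← Matrix.conjTranspose_mul, e1, Matrix.conjTranspose_one]
    have : star y * P * y = A - B := by
      calc star y * P * y = (star y * (y⁻¹).conjTranspose) * (A - B) * (y⁻¹ * y) := by
            rw [hPdef]; simp only [mul_assoc]
        _ = A - B := by rw [e1, e2, one_mul, mul_one]
    rw [mul_add, add_mul, mul_one, this, ← hBy]; abel
  have hd : A.det = B.det * (1 + P).det := by
    rw [hA, hBy, Matrix.det_mul, Matrix.det_mul, Matrix.det_mul]; ring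
  have hBp := hB.det_pos
  rw [Complex.lt_def] at hBp
  have h1 := aux_one_le_det hP
  rw [hd, Complex.mul_re, ← hBp.2]
  have := hBp.1
  simp only [Complex.zero_re, Complex.zero_im, zero_mul, sub_zero] at this ⊢
  nlinarith

/-! ### The complex Hessian as a quadratic form -/

/-- The sesquilinear form attached to a real bilinear form. -/
def hs (B : Cn n →L[ℝ] Cn n →L[ℝ] ℝ) (x y : Cn n) : ℂ :=
  ((B x y + B (Complex.I • x) (Complex.I • y) : ℝ) : ℂ) +
    Complex.I * ((B x (Complex.I • y) - B (Complex.I • x) y : ℝ) : ℂ)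

theorem hs_add_left (B : Cn n →L[ℝ] Cn n →L[ℝ] ℝ) (x x' y : Cn n) :
    hs B (x + x') y = hs B x y + hs B x' y := by
  simp [hs]; ring

theorem hs_add_right (B : Cn n →L[ℝ] Cn n →L[ℝ] ℝ) (x y y' : Cn n) :
    hs B x (y + y') = hs B x y + hs B x y' := by
  simp [hs]; ring

theorem smul_decomp (c : ℂ) (x : Cn n) : c • x = c.re • x + c.im • (Complex.I • x) := by
  ext i
  simp
  conv_lhs => rw [← Complex.re_add_im c]
  ring

theorem hs_smul_left (B : Cn n →L[ℝ] Cn n →L[ℝ] ℝ) (c : ℂ) (x y : Cn n) :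
    hs B (c • x) y = c * hs B x y := by
  have h1 : ∀ (r : ℝ) (x : Cn n), hs B (r • x) y = r * hs B x y := by
    intro r x
    simp [hs, smul_comm Complex.I r]; ring
  have h2 : ∀ x : Cn n, hs B (Complex.I • x) y = Complex.I * hs B x y := by
    intro x
    simp only [hs, smul_smul, Complex.I_mul_I, neg_smul, one_smul, map_neg,
      _root_.neg_apply]
    push_cast
    linear_combination (-(B x (Complex.I • y) : ℂ) + B (Complex.I • x) y) * Complex.I_sq
  rw [smul_decomp, hs_add_left, h1, h1, h2]
  conv_rhs => rw [← Complex.re_add_im c]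
  ring

theorem hs_smul_right (B : Cn n →L[ℝ] Cn n →L[ℝ] ℝ) (c : ℂ) (x y : Cn n) :
    hs B x (c • y) = star c * hs B x y := by
  have h1 : ∀ (r : ℝ) (y : Cn n), hs B x (r • y) = r * hs B x y := by
    intro r y
    simp [hs, smul_comm Complex.I r]; ring
  have h2 : ∀ y : Cn n, hs B x (Complex.I • y) = - Complex.I * hs B x y := by
    intro y
    simp only [hs, smul_smul, Complex.I_mul_I, neg_smul, one_smul, map_neg]
    push_cast
    linear_combination ((B x (Complex.I • y) : ℂ) - B (Complex.I • x) y) * Complex.I_sq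
  rw [smul_decomp, hs_add_right, h1, h1, h2]
  have : star c = c.re - c.im * Complex.I := by
    apply Complex.ext <;> simp
  rw [this]
  ring

theorem hs_zero_left (B : Cn n →L[ℝ] Cn n →L[ℝ] ℝ) (y : Cn n) : hs B 0 y = 0 := by
  simp [hs]

theorem hs_zero_right (B : Cn n →L[ℝ] Cn n →L[ℝ] ℝ) (x : Cn n) : hs B x 0 = 0 := by
  simp [hs]

theorem hs_sum_left (B : Cn n →L[ℝ] Cn n →L[ℝ] ℝ) (s : Finset (Fin n)) (g : Fin n → Cn n)
    (y : Cn n) : hs B (∑ i ∈ s, g i) y = ∑ i ∈ s, hs B (g i) y := by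
  classical
  induction s using Finset.induction_on with
  | empty => simp [hs_zero_left]
  | insert a s ha ih => rw [Finset.sum_insert ha, Finset.sum_insert ha, hs_add_left, ih]

theorem hs_sum_right (B : Cn n →L[ℝ] Cn n →L[ℝ] ℝ) (s : Finset (Fin n)) (g : Fin n → Cn n)
    (x : Cn n) : hs B x (∑ i ∈ s, g i) = ∑ i ∈ s, hs B x (g i) := by
  classical
  induction s using Finset.induction_on with
  | empty => simp [hs_zero_right]
  | insert a s ha ih => rw [Finset.sum_insert ha, Finset.sum_insert ha, hs_add_right, ih]

theorem cvec_I (α : Fin n) : cvec n α Complex.I = Complex.I • cvec n α 1 := by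
  ext i
  simp [cvec]

theorem vec_decomp (a : Cn n) : a = ∑ α, a α • cvec n α 1 := by
  ext i
  simp [cvec, Pi.single_apply]

theorem hs_expand (B : Cn n →L[ℝ] Cn n →L[ℝ] ℝ) (a : Cn n) :
    hs B a a = ∑ α, ∑ β, a α * star (a β) * hs B (cvec n α 1) (cvec n β 1) := by
  conv_lhs => rw [vec_decomp a]
  rw [hs_sum_left]
  refine Finset.sum_congr rfl fun α _ => ?_
  rw [hs_sum_right]
  refine Finset.sum_congr rfl fun β _ => ?_
  rw [hs_smul_left, hs_smul_right]; ring

theorem cHess_apply {u : Cn n → ℝ} {z : Cn n} (hu : ContDiffAt ℝ 2 u z) (α β : Fin n) :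
    cHess u z α β = hs (fderiv ℝ (fderiv ℝ u) z) (cvec n α 1) (cvec n β 1) / 4 := by
  have hev : ∀ᶠ w in 𝓝 z, DifferentiableAt ℝ u w := by
    have := hu.eventually (by simp)
    filter_upwards [this] with w hw
    exact hw.differentiableAt (by simp)
  have h2 : DifferentiableAt ℝ (fderiv ℝ u) z :=
    (hu.fderiv_right (m := 1) (by norm_num)).differentiableAt (by simp)
  set B := fderiv ℝ (fderiv ℝ u) z with hB
  have hBd : ∀ v : Cn n, HasFDerivAt (fun w => ((fderiv ℝ u w v : ℝ) : ℂ))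
      (Complex.ofRealCLM.comp ((ContinuousLinearMap.apply ℝ ℝ v).comp B)) z := by
    intro v
    exact Complex.ofRealCLM.hasFDerivAt.comp z
      ((ContinuousLinearMap.apply ℝ ℝ v).hasFDerivAt.comp z h2.hasFDerivAt)
  have he : wderBarW univ β (fun w => (u w : ℂ)) =ᶠ[𝓝 z] fun w =>
      (2⁻¹ : ℂ) • (((fderiv ℝ u w (cvec n β 1) : ℝ) : ℂ) +
        Complex.I • ((fderiv ℝ u w (cvec n β Complex.I) : ℝ) : ℂ)) := by
    filter_upwards [hev] with w hw
    have : fderiv ℝ (fun w => (u w : ℂ)) w = Complex.ofRealCLM.comp (fderiv ℝ u w) :=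
      (Complex.ofRealCLM.hasFDerivAt.comp w hw.hasFDerivAt).fderiv
    simp [wderBarW, fderivWithin_univ, this]
    ring
  have hd := (((hBd (cvec n β 1)).add
    ((hBd (cvec n β Complex.I)).const_smul Complex.I)).const_smul (2⁻¹ : ℂ))
  have hd' := (hd.congr_of_eventuallyEq he).fderiv
  have key : ∀ v : Cn n, fderiv ℝ (wderBarW univ β (fun w => (u w : ℂ))) z v =
      (2⁻¹ : ℂ) * ((B v (cvec n β 1) : ℂ) + Complex.I * (B v (cvec n β Complex.I) : ℂ)) := by
    intro v
    rw [hd']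
    simp
    ring
  simp only [cHess, cHessW, Matrix.of_apply, wderW, fderivWithin_univ, key, hs, cvec_I]
  push_cast
  linear_combination (-(B (Complex.I • cvec n α 1) (Complex.I • cvec n β 1) : ℂ) / 4) * Complex.I_sq

theorem snd_symm {u : Cn n → ℝ} {z : Cn n} (hu : ContDiffAt ℝ 2 u z) (x y : Cn n) :
    fderiv ℝ (fderiv ℝ u) z x y = fderiv ℝ (fderiv ℝ u) z y x :=
  hu.isSymmSndFDerivAt (by simp) x y

theorem hs_self {u : Cn n → ℝ} {z : Cn n} (hu : ContDiffAt ℝ 2 u z) (a : Cn n) :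
    hs (fderiv ℝ (fderiv ℝ u) z) a a =
      ((fderiv ℝ (fderiv ℝ u) z a a +
        fderiv ℝ (fderiv ℝ u) z (Complex.I • a) (Complex.I • a) : ℝ) : ℂ) := by
  rw [hs, snd_symm hu (Complex.I • a) a]; simp

theorem cHess_hermitian {u : Cn n → ℝ} {z : Cn n} (hu : ContDiffAt ℝ 2 u z) :
    (cHess u z).IsHermitian := by
  ext α β
  rw [Matrix.conjTranspose_apply, cHess_apply hu, cHess_apply hu]
  simp only [hs, snd_symm hu (cvec n β 1), snd_symm hu (Complex.I • cvec n β 1)]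
  apply Complex.ext <;> simp

/-- The vector of `ℂⁿ` conjugate to `x`. -/
def cj (x : Fin n → ℂ) : Cn n := WithLp.toLp 2 (star x)

theorem cHess_quad {u : Cn n → ℝ} {z : Cn n} (hu : ContDiffAt ℝ 2 u z) (x : Fin n → ℂ) :
    star x ⬝ᵥ (cHess u z).mulVec x =
      (((fderiv ℝ (fderiv ℝ u) z (cj x) (cj x) +
        fderiv ℝ (fderiv ℝ u) z (Complex.I • cj x) (Complex.I • cj x)) / 4 : ℝ) : ℂ) := by
  have h := hs_self hu (cj x)
  rw [hs_expand] at h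
  rw [Complex.ofReal_div, ← h]
  simp only [dotProduct, Matrix.mulVec, cHess_apply hu, Finset.mul_sum, Finset.sum_div]
  refine Finset.sum_congr rfl fun α _ => Finset.sum_congr rfl fun β _ => ?_
  simp [cj]
  ring

/-! ### Second derivative test -/

theorem snd_deriv_le {g : ℝ → ℝ} {x : ℝ} (hc : ContinuousAt g x) (hm : IsLocalMax g x) :
    deriv (deriv g) x ≤ 0 := by
  by_contra hcon
  push Not at hcon
  have h0 : deriv g x = 0 := hm.deriv_eq_zero
  have hmin := isLocalMin_of_deriv_deriv_pos hcon h0 hc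
  have hEq : g =ᶠ[𝓝 x] fun _ => g x := by
    filter_upwards [hm, hmin] with y h1 h2
    exact le_antisymm h1 h2
  have h3 : deriv g =ᶠ[𝓝 x] fun _ => 0 := by
    have := hEq.deriv
    simpa using! this
  have h4 := h3.deriv_eq
  simp at h4
  linarith

theorem snd_fderiv_le {g : Cn n → ℝ} {z : Cn n} (hg : ContDiffAt ℝ 2 g z)
    (hm : IsLocalMax g z) (a : Cn n) : fderiv ℝ (fderiv ℝ g) z a a ≤ 0 := by
  have hl : ∀ s : ℝ, HasDerivAt (fun s : ℝ => z + s • a) a s := by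
    intro s
    have := ((hasDerivAt_id s).smul_const a).const_add z
    simpa using! this
  have hcont : ContinuousAt (fun s : ℝ => z + s • a) 0 := (hl 0).continuousAt
  have ht : Tendsto (fun s : ℝ => z + s • a) (𝓝 0) (𝓝 z) := by
    have := hcont.tendsto
    simpa using this
  have hz : z + (0 : ℝ) • a = z := by simp
  have hev : ∀ᶠ w in 𝓝 z, DifferentiableAt ℝ g w := by
    have := hg.eventually (by simp)
    filter_upwards [this] with w hw
    exact hw.differentiableAt (by simp)
  have h2 : DifferentiableAt ℝ (fderiv ℝ g) z :=
    (hg.fderiv_right (m := 1) (by norm_num)).differentiableAt (by simp)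
  have hd1 : deriv (fun s : ℝ => g (z + s • a)) =ᶠ[𝓝 0] fun s => fderiv ℝ g (z + s • a) a := by
    filter_upwards [ht.eventually hev] with s hs
    exact (hs.hasFDerivAt.comp_hasDerivAt s (hl s)).deriv
  have hd2 : deriv (deriv (fun s : ℝ => g (z + s • a))) 0 = fderiv ℝ (fderiv ℝ g) z a a := by
    rw [hd1.deriv_eq]
    have h3 : HasFDerivAt (fderiv ℝ g) (fderiv ℝ (fderiv ℝ g) z) (z + (0 : ℝ) • a) := by
      rw [hz]; exact h2.hasFDerivAt
    have h4 := h3.comp_hasDerivAt (0 : ℝ) (hl 0)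
    have h5 := (ContinuousLinearMap.apply ℝ ℝ a).hasFDerivAt.comp_hasDerivAt (0 : ℝ) h4
    exact h5.deriv
  rw [← hd2]
  apply snd_deriv_le
  · have : ContinuousAt g (z + (0 : ℝ) • a) := by rw [hz]; exact hg.continuousAt
    exact ContinuousAt.comp (f := fun s : ℝ => z + s • a) this hcont
  · have := ht.eventually hm
    filter_upwards [this] with s hs
    simpa using hs

theorem snd_fderiv_mono {a b : Cn n → ℝ} {z : Cn n} (ha : ContDiffAt ℝ 2 a z)
    (hb : ContDiffAt ℝ 2 b z) (hm : IsLocalMax (fun w => a w - b w) z) (x : Cn n) :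
    fderiv ℝ (fderiv ℝ a) z x x ≤ fderiv ℝ (fderiv ℝ b) z x x := by
  have h := snd_fderiv_le (ha.sub hb) hm x
  have hda : ∀ {u : Cn n → ℝ}, ContDiffAt ℝ 2 u z → ∀ᶠ w in 𝓝 z, DifferentiableAt ℝ u w := by
    intro u hu
    have := hu.eventually (by simp)
    filter_upwards [this] with w hw
    exact hw.differentiableAt (by simp)
  have h2 : ∀ {u : Cn n → ℝ}, ContDiffAt ℝ 2 u z → DifferentiableAt ℝ (fderiv ℝ u) z := by
    intro u hu
    exact (hu.fderiv_right (m := 1) (by norm_num)).differentiableAt (by simp)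
  have he : fderiv ℝ (fun w => a w - b w) =ᶠ[𝓝 z] fun w => fderiv ℝ a w - fderiv ℝ b w := by
    filter_upwards [hda ha, hda hb] with w h1 h2
    exact fderiv_fun_sub h1 h2
  have h3 := he.fderiv_eq (𝕜 := ℝ)
  have h3' := fderiv_fun_sub (𝕜 := ℝ) (h2 ha) (h2 hb)
  rw [h3'] at h3
  have h4 : fderiv ℝ (fderiv ℝ (fun w => a w - b w)) z x x =
    fderiv ℝ (fderiv ℝ a) z x x - fderiv ℝ (fderiv ℝ b) z x x := by
    rw [h3]; simp
  linarith

theorem logdet_le {a b : Cn n → ℝ} {z : Cn n} (ha : ContDiffAt ℝ 2 a z)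
    (hb : ContDiffAt ℝ 2 b z) (hm : IsLocalMax (fun w => a w - b w) z)
    (hpa : (cHess a z).PosDef) :
    Real.log (cHess a z).det.re ≤ Real.log (cHess b z).det.re := by
  have hpos : 0 < (cHess a z).det.re := by
    have := hpa.det_pos
    rw [Complex.lt_def] at this
    simpa using this.1
  apply Real.log_le_log hpos
  apply aux_det_mono hpa
  refine Matrix.PosSemidef.of_dotProduct_mulVec_nonneg
    ((cHess_hermitian hb).sub (cHess_hermitian ha)) fun x => ?_
  rw [Matrix.sub_mulVec, dotProduct_sub, cHess_quad hb, cHess_quad ha, ← Complex.ofReal_sub]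
  have h1 := snd_fderiv_mono ha hb hm (cj x)
  have h2 := snd_fderiv_mono ha hb hm (Complex.I • cj x)
  exact Complex.zero_le_real.2 (by linarith)

theorem cHess_normsq (z : Cn n) : cHess (fun w : Cn n => ‖w‖ ^ 2) z = 1 := by
  have hc : ContDiffAt ℝ 2 (fun w : Cn n => ‖w‖ ^ 2) z := (contDiff_norm_sq ℝ).contDiffAt
  have h1 : fderiv ℝ (fun w : Cn n => ‖w‖ ^ 2) = fun w => 2 • (innerSL ℝ w) := by
    ext1 w
    exact (hasStrictFDerivAt_norm_sq w).hasFDerivAt.fderiv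
  have h2 : ∀ x y : Cn n, fderiv ℝ (fderiv ℝ (fun w : Cn n => ‖w‖ ^ 2)) z x y
      = 2 * inner ℝ x y := by
    intro x y
    rw [h1]
    have : HasFDerivAt (fun w : Cn n => 2 • (innerSL ℝ w)) (2 • innerSL ℝ) z :=
      (innerSL ℝ (E := Cn n)).hasFDerivAt.const_smul 2
    rw [this.fderiv]
    simp only [_root_.smul_apply, nsmul_eq_mul, Nat.cast_ofNat]
    rfl
  ext α β
  rw [cHess_apply hc]
  have hi : ∀ c d : ℂ, (inner ℝ (cvec n α c) (cvec n β d) : ℝ) =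
      if α = β then (d * (starRingEnd ℂ) c).re else 0 := by
    intro c d
    rw [PiLp.inner_apply, Finset.sum_eq_single α]
    · by_cases h : α = β
      · subst h; simp [cvec, Complex.inner]
      · simp [cvec, h]
    · intro i _ hi
      simp [cvec, hi]
    · simp
  simp only [hs, h2, ← cvec_I, hi]
  by_cases h : α = β
  · subst h
    simp
    norm_num
  · simp [h]

theorem cHess_const_mul {u : Cn n → ℝ} {z : Cn n} (c : ℝ) (hu : ContDiffAt ℝ 2 u z) :
    cHess (fun w => c * u w) z = (c : ℂ) • cHess u z := by
  have hc : ContDiffAt ℝ 2 (fun w => c * u w) z := contDiffAt_const.mul hu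
  have h1 : fderiv ℝ (fun w => c * u w) = fun w => c • fderiv ℝ u w := by
    ext1 w
    exact congrFun (fderiv_const_smul_field (𝕜 := ℝ) (f := u) c) w
  have h2 : fderiv ℝ (fderiv ℝ (fun w => c * u w)) z = c • fderiv ℝ (fderiv ℝ u) z := by
    rw [h1]
    exact congrFun (fderiv_const_smul_field (𝕜 := ℝ) (f := fderiv ℝ u) c) z
  ext α β
  rw [Matrix.smul_apply, cHess_apply hc, cHess_apply hu, h2]
  simp [hs]
  ring

/-! ### Comparison principle -/

theorem left_max_deriv {g : ℝ → ℝ} {t : ℝ} (ht : 0 < t) (hg : DifferentiableAt ℝ g t)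
    (hm : ∀ s ∈ Ioc 0 t, g s ≤ g t) : 0 ≤ deriv g t := by
  have h1 := hg.hasDerivAt.tendsto_slope
  have h2 : Tendsto (slope g t) (𝓝[<] t) (𝓝 (deriv g t)) :=
    h1.mono_left (nhdsWithin_mono _ (fun x hx => ne_of_lt hx))
  refine ge_of_tendsto h2 ?_
  filter_upwards [Ioo_mem_nhdsLT ht] with s hs
  rw [slope_def_field]
  have := hm s ⟨hs.1, hs.2.le⟩
  exact div_nonneg_of_nonpos (by linarith) (by linarith [hs.2])

theorem comparison {Ω : Set (Cn n)} (hΩo : IsOpen Ω) (hΩb : IsBounded Ω) {τ M B : ℝ}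
    (hB : 0 ≤ B) (a b : Cn n × ℝ → ℝ)
    (hac : ContinuousOn a (closure Ω ×ˢ Icc 0 τ)) (hbc : ContinuousOn b (closure Ω ×ˢ Icc 0 τ))
    (ha2 : ∀ z ∈ Ω, ∀ t ∈ Ioc 0 τ, ContDiffAt ℝ 2 (fun w => a (w, t)) z)
    (hb2 : ∀ z ∈ Ω, ∀ t ∈ Ioc 0 τ, ContDiffAt ℝ 2 (fun w => b (w, t)) z)
    (hat : ∀ z ∈ Ω, ∀ t ∈ Ioc 0 τ, DifferentiableAt ℝ (fun s => a (z, s)) t)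
    (hbt : ∀ z ∈ Ω, ∀ t ∈ Ioc 0 τ, DifferentiableAt ℝ (fun s => b (z, s)) t)
    (hap : ∀ z ∈ Ω, ∀ t ∈ Ioc 0 τ, (cHess (fun w => a (w, t)) z).PosDef)
    (h0 : ∀ z ∈ Ω, a (z, 0) - b (z, 0) ≤ M)
    (hbd : ∀ z ∈ frontier Ω, ∀ t ∈ Icc 0 τ, a (z, t) - b (z, t) ≤ M)
    (hinterior : ∀ z ∈ Ω, ∀ t ∈ Ioc 0 τ, M < a (z, t) - b (z, t) →
      Real.log (cHess (fun w => a (w, t)) z).det.re ≤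
        Real.log (cHess (fun w => b (w, t)) z).det.re →
      deriv (fun s => a (z, s)) t - deriv (fun s => b (z, s)) t < B) :
    ∀ z ∈ closure Ω, ∀ t ∈ Icc 0 τ, a (z, t) - b (z, t) ≤ M + B * t := by
  have hcomp : IsCompact (closure Ω ×ˢ Icc 0 τ) :=
    hΩb.isCompact_closure.prod isCompact_Icc
  intro z1 hz1 t1 ht1
  by_contra hcon
  push Not at hcon
  have hgc : ContinuousOn (fun p : Cn n × ℝ => a p - b p - B * p.2) (closure Ω ×ˢ Icc 0 τ) :=
    (hac.sub hbc).sub (by fun_prop)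
  obtain ⟨⟨z, t⟩, hp, hmax⟩ := hcomp.exists_isMaxOn ⟨(z1, t1), hz1, ht1⟩ hgc
  have hgt : M < a (z, t) - b (z, t) - B * t := by
    have := hmax (show (z1, t1) ∈ closure Ω ×ˢ Icc 0 τ from ⟨hz1, ht1⟩)
    simp only [mem_ofPred_eq] at this
    linarith
  have hz : z ∈ closure Ω := hp.1
  have ht : t ∈ Icc 0 τ := hp.2
  have hBt : 0 ≤ B * t := mul_nonneg hB ht.1
  have hzΩ : z ∈ Ω := by
    by_contra hz'
    have : z ∈ frontier Ω := by
      rw [frontier, hΩo.interior_eq]; exact ⟨hz, hz'⟩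
    have := hbd z this t ht
    linarith
  have ht0 : 0 < t := by
    rcases ht.1.lt_or_eq with h | h
    · exact h
    · subst h
      have := h0 z hzΩ
      linarith
  have ht' : t ∈ Ioc 0 τ := ⟨ht0, ht.2⟩
  have hlm : IsLocalMax (fun w => a (w, t) - b (w, t)) z := by
    filter_upwards [hΩo.mem_nhds hzΩ] with w hw
    have := hmax (show (w, t) ∈ closure Ω ×ˢ Icc 0 τ from ⟨subset_closure hw, ht⟩)
    simp only [mem_ofPred_eq] at this
    linarith
  have hlog := logdet_le (ha2 z hzΩ t ht') (hb2 z hzΩ t ht') hlm (hap z hzΩ t ht')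
  have hlt := hinterior z hzΩ t ht' (by linarith) hlog
  have hda := (hat z hzΩ t ht').hasDerivAt
  have hdb := (hbt z hzΩ t ht').hasDerivAt
  have hdd := (hda.sub hdb).sub ((hasDerivAt_id t).const_mul B)
  have hnn := left_max_deriv ht0 hdd.differentiableAt (by
    intro s hs
    have := hmax (show (z, s) ∈ closure Ω ×ˢ Icc 0 τ from ⟨hz, hs.1.le, hs.2.trans ht.2⟩)
    simpa using this)
  rw [hdd.deriv] at hnn
  linarith

/-! ### Consequences of the a priori hypotheses -/

theorem nonpos_on_closure {X : Type*} [TopologicalSpace X] {F : X → ℝ} {S S' : Set X}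
    (hSS : S ⊆ S') (hcl : S' ⊆ closure S) (hF : ContinuousOn F S') (h : ∀ x ∈ S, F x ≤ 0) :
    ∀ x ∈ S', F x ≤ 0 := by
  intro x hx
  have h1 : ContinuousWithinAt F S x := (hF x hx).mono hSS
  have : (𝓝[S] x).NeBot := mem_closure_iff_nhdsWithin_neBot.1 (hcl hx)
  exact le_of_tendsto h1.tendsto (eventually_mem_nhdsWithin.mono h)

section apriori

variable {Ω : Set (Cn n)} {T Cu Cφv Cf : ℝ} {u φ : Cn n × ℝ → ℝ} {f : ℝ × Cn n × ℝ → ℝ}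

theorem ap_u_at (hΩo : IsOpen Ω) (h : AprioriHyps n Ω T Cu Cφv Cf u φ f) {z : Cn n} (hz : z ∈ Ω)
    {t : ℝ} (ht : t ∈ Ioo 0 T) : ContDiffAt ℝ (⊤ : ℕ∞) u (z, t) :=
  h.2.2.1.contDiffAt ((hΩo.prod isOpen_Ioo).mem_nhds ⟨hz, ht⟩)

theorem ap_u_C2 (hΩo : IsOpen Ω) (h : AprioriHyps n Ω T Cu Cφv Cf u φ f) {z : Cn n} (hz : z ∈ Ω)
    {t : ℝ} (ht : t ∈ Ioo 0 T) : ContDiffAt ℝ 2 (fun w => u (w, t)) z := by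
  have h1 : ContDiffAt ℝ 2 u (z, t) := (ap_u_at hΩo h hz ht).of_le (by exact WithTop.coe_le_coe.2 le_top)
  exact h1.comp z (f := fun w => (w, t)) (by fun_prop)

theorem ap_u_dt (hΩo : IsOpen Ω) (h : AprioriHyps n Ω T Cu Cφv Cf u φ f) {z : Cn n} (hz : z ∈ Ω)
    {t : ℝ} (ht : t ∈ Ioo 0 T) : DifferentiableAt ℝ (fun s => u (z, s)) t := by
  have h1 : DifferentiableAt ℝ u (z, t) := (ap_u_at hΩo h hz ht).differentiableAt (by simp)
  exact h1.comp t (f := fun s => (z, s)) (by fun_prop)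

theorem ap_u_cont (hΩb : IsBounded Ω) (h : AprioriHyps n Ω T Cu Cφv Cf u φ f) {τ : ℝ}
    (hτ : τ < T) : ContinuousOn u (closure Ω ×ˢ Icc 0 τ) := by
  obtain ⟨hc1, hc2, hc3, -⟩ := h.2.2.2.1
  have hsub : Icc 0 τ ⊆ Ico 0 T := fun s hs => ⟨hs.1, hs.2.trans_lt hτ⟩
  have hcomp : IsCompact (closure Ω ×ˢ Icc 0 τ) :=
    hΩb.isCompact_closure.prod isCompact_Icc
  obtain ⟨C, hC⟩ := hcomp.exists_bound_of_continuousOn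
    (hc3.mono (Set.prod_mono Subset.rfl hsub))
  refine continuousOn_prod_of_continuousOn_lipschitzOnWith' u (Real.toNNReal C) ?_ ?_
  · intro z hz
    refine Convex.lipschitzOnWith_of_nnnorm_hasDerivWithin_le (convex_Icc 0 τ)
      (f' := fun s => derivWithin (fun s => u (z, s)) (Ico 0 T) s) ?_ ?_
    · intro s hs
      exact (((hc2 z hz).differentiableOn (by simp) s (hsub hs)).hasDerivWithinAt).mono hsub
    · intro s hs
      have := hC (z, s) ⟨hz, hs⟩
      rw [← NNReal.coe_le_coe, coe_nnnorm]
      exact this.trans (Real.le_coe_toNNReal C)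
  · intro t ht
    exact (hc1 t (hsub ht)).continuousOn

theorem ap_phi_cont (h : AprioriHyps n Ω T Cu Cφv Cf u φ f) :
    ContinuousOn φ (closure Ω ×ˢ Ico 0 T) := h.1.continuousOn

theorem ap_phi_bound (hT : 0 < T) (h : AprioriHyps n Ω T Cu Cφv Cf u φ f) :
    ∀ z ∈ closure Ω, ∀ t ∈ Ico 0 T, |φ (z, t)| ≤ |Cφv| := by
  intro z hz t ht
  have hφ := h.2.2.2.2.2.2.2.2.2.2
  have := nonpos_on_closure (S := Ω ×ˢ Ioo 0 T) (S' := closure Ω ×ˢ Ico 0 T)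
    (F := fun p => |φ p| - |Cφv|) (Set.prod_mono subset_closure Ioo_subset_Ico_self)
    (by
      rw [closure_prod_eq, closure_Ioo hT.ne]
      exact Set.prod_mono Subset.rfl Ico_subset_Icc_self)
    ((ap_phi_cont h).abs.sub continuousOn_const)
    (by
      rintro ⟨w, s⟩ ⟨hw, hs⟩
      have := hφ 0 0 (by norm_num) w hw s hs
      simp only [norm_iteratedFDeriv_zero, iteratedDeriv_zero, Real.norm_eq_abs] at this
      linarith [le_abs_self Cφv]) (z, t) ⟨hz, ht⟩
  simpa using this

theorem ap_phi_lip (hΩo : IsOpen Ω) (hT : 0 < T) (h : AprioriHyps n Ω T Cu Cφv Cf u φ f) :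
    ∀ z ∈ closure Ω, ∀ t ∈ Ico 0 T, ∀ s ∈ Ico 0 T, |φ (z, t) - φ (z, s)| ≤ |Cφv| * |t - s| := by
  intro z hz t ht s hs
  have hφ := h.2.2.2.2.2.2.2.2.2.2
  have hmem : ∀ p ∈ closure Ω ×ˢ (Ico 0 T ×ˢ Ico 0 T),
      (p.1, p.2.1) ∈ closure Ω ×ˢ Ico 0 T ∧ (p.1, p.2.2) ∈ closure Ω ×ˢ Ico 0 T := by
    rintro ⟨a, b, c⟩ ⟨h1, h2, h3⟩
    exact ⟨⟨h1, h2⟩, ⟨h1, h3⟩⟩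
  have := nonpos_on_closure (S := Ω ×ˢ (Ioo 0 T ×ˢ Ioo 0 T))
    (S' := closure Ω ×ˢ (Ico 0 T ×ˢ Ico 0 T))
    (F := fun p => |φ (p.1, p.2.1) - φ (p.1, p.2.2)| - |Cφv| * |p.2.1 - p.2.2|)
    (Set.prod_mono subset_closure (Set.prod_mono Ioo_subset_Ico_self Ioo_subset_Ico_self))
    (by
      rw [closure_prod_eq, closure_prod_eq, closure_Ioo hT.ne]
      exact Set.prod_mono Subset.rfl (Set.prod_mono Ico_subset_Icc_self Ico_subset_Icc_self))
    (by
      have c1 : ContinuousOn (fun p : Cn n × ℝ × ℝ => φ (p.1, p.2.1))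
          (closure Ω ×ˢ (Ico 0 T ×ˢ Ico 0 T)) :=
        (ap_phi_cont h).comp (f := fun p : Cn n × ℝ × ℝ => (p.1, p.2.1)) (by fun_prop)
          (fun p hp => (hmem p hp).1)
      have c2 : ContinuousOn (fun p : Cn n × ℝ × ℝ => φ (p.1, p.2.2))
          (closure Ω ×ˢ (Ico 0 T ×ˢ Ico 0 T)) :=
        (ap_phi_cont h).comp (f := fun p : Cn n × ℝ × ℝ => (p.1, p.2.2)) (by fun_prop)
          (fun p hp => (hmem p hp).2)
      exact (c1.sub c2).abs.sub (by fun_prop))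
    (by
      rintro ⟨w, a, b⟩ ⟨hw, ha, hb⟩
      have hd : ∀ r ∈ Ioo 0 T, DifferentiableAt ℝ (fun s => φ (w, s)) r := by
        intro r hr
        have h1 : DifferentiableAt ℝ φ (w, r) := by
          refine ContDiffAt.differentiableAt (n := (⊤ : ℕ∞)) (h.1.contDiffAt ?_) (by simp)
          exact mem_of_superset ((hΩo.prod isOpen_Ioo).mem_nhds ⟨hw, hr⟩)
            (Set.prod_mono subset_closure Ioo_subset_Ico_self)
        exact h1.comp r (f := fun s => (w, s)) (by fun_prop)
      have := (convex_Ioo 0 T).norm_image_sub_le_of_norm_deriv_le (C := |Cφv|) hd (by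
        intro r hr
        have := hφ 0 1 (by norm_num) w hw r hr
        simp only [norm_iteratedFDeriv_zero, iteratedDeriv_one] at this
        exact this.trans (le_abs_self _)) hb ha
      simp only [Real.norm_eq_abs] at this
      simpa using this) (z, t, s) ⟨hz, ht, hs⟩
  simpa using this

theorem ap_f_diff (hΩo : IsOpen Ω) (h : AprioriHyps n Ω T Cu Cφv Cf u φ f) {z : Cn n} (hz : z ∈ Ω)
    {t : ℝ} (ht : t ∈ Ioo 0 T) (r : ℝ) : DifferentiableAt ℝ f (t, z, r) := by
  refine ContDiffAt.differentiableAt (n := (⊤ : ℕ∞)) (h.2.1.contDiffAt ?_) (by simp)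
  exact mem_of_superset ((isOpen_Ioo.prod (hΩo.prod isOpen_univ)).mem_nhds ⟨ht, hz, mem_univ r⟩)
    (Set.prod_mono Ioo_subset_Ico_self (Set.prod_mono subset_closure Subset.rfl))

theorem ap_f_bound (h : AprioriHyps n Ω T Cu Cφv Cf u φ f) {z : Cn n} (hz : z ∈ Ω)
    {t : ℝ} (ht : t ∈ Ioo 0 T) (r : ℝ) : |f (t, z, r)| ≤ |Cf| := by
  have := h.2.2.2.2.2.2.2.2.2.1 0 (by norm_num) (t, z, r) ⟨ht, hz, mem_univ r⟩
  rw [norm_iteratedFDeriv_zero, Real.norm_eq_abs] at this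
  exact this.trans (le_abs_self _)

theorem ap_f_anti (hΩo : IsOpen Ω) (h : AprioriHyps n Ω T Cu Cφv Cf u φ f) {z : Cn n} (hz : z ∈ Ω)
    {t : ℝ} (ht : t ∈ Ioo 0 T) : Antitone (fun r => f (t, z, r)) := by
  refine antitone_of_deriv_nonpos ?_ (h.2.2.2.2.2.2.2.2.1 t ht z hz)
  intro r
  exact (ap_f_diff hΩo h hz ht r).comp r (f := fun r => (t, z, r)) (by fun_prop)

theorem ap_f_lip (hΩo : IsOpen Ω) (h : AprioriHyps n Ω T Cu Cφv Cf u φ f) {z : Cn n} (hz : z ∈ Ω)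
    {t s : ℝ} (ht : t ∈ Ioo 0 T) (hs : s ∈ Ioo 0 T) (r : ℝ) :
    |f (t, z, r) - f (s, z, r)| ≤ |Cf| * |t - s| := by
  have := (convex_Ioo 0 T).norm_image_sub_le_of_norm_hasDerivWithin_le (C := |Cf|)
    (f := fun s => f (s, z, r)) (f' := fun s => fderiv ℝ f (s, z, r) (1, 0, 0)) (by
      intro s hs
      have h1 := (ap_f_diff hΩo h hz hs r).hasFDerivAt
      have h2 : HasDerivAt (fun s : ℝ => (s, z, r)) (1, 0, 0) s :=
        (hasDerivAt_id s).prodMk ((hasDerivAt_const s z).prodMk (hasDerivAt_const s r))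
      exact (h1.comp_hasDerivAt s h2).hasDerivWithinAt) (by
      intro s hs
      have h1 := h.2.2.2.2.2.2.2.2.2.1 1 (by norm_num) (s, z, r) ⟨hs, hz, mem_univ r⟩
      rw [norm_iteratedFDeriv_one] at h1
      have h2 := (fderiv ℝ f (s, z, r)).le_opNorm (1, 0, 0)
      have h3 : ‖((1, 0, 0) : ℝ × Cn n × ℝ)‖ = 1 := by simp [Prod.norm_def]
      rw [h3, mul_one] at h2
      exact h2.trans (h1.trans (le_abs_self _))) hs ht
  simpa using this

end apriori

section main

variable {Ω : Set (Cn n)} {T Cu Cφv Cf : ℝ} {u φ : Cn n × ℝ → ℝ} {f : ℝ × Cn n × ℝ → ℝ}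

theorem posDef_one_normsq (z : Cn n) : (cHess (fun w : Cn n => ‖w‖ ^ 2) z).PosDef := by
  rw [cHess_normsq]; exact Matrix.PosDef.one

theorem Ioc_sub {τ : ℝ} (hτ : τ < T) {t : ℝ} (ht : t ∈ Ioc 0 τ) : t ∈ Ioo 0 T :=
  ⟨ht.1, ht.2.trans_lt hτ⟩

/-- The uniform bound on `|u|`. -/
theorem ap_u_bound (hΩo : IsOpen Ω) (hΩb : IsBounded Ω) (hT : 0 < T) {R : ℝ} (hR0 : 0 ≤ R)
    (hR : ∀ z ∈ closure Ω, ‖z‖ ^ 2 ≤ R)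
    (h : AprioriHyps n Ω T Cu Cφv Cf u φ f) :
    ∀ z ∈ closure Ω, ∀ t ∈ Ico 0 T, |u (z, t)| ≤ |Cu| + |Cφv| + R + (|Cf| + 1) * T := by
  intro z hz τ hτ
  have hB : 0 ≤ |Cf| + 1 := by positivity
  have hqc : ContinuousOn (fun p : Cn n × ℝ => ‖p.1‖ ^ 2) (closure Ω ×ˢ Icc 0 τ) := by fun_prop
  have hq2 : ∀ z : Cn n, ContDiffAt ℝ 2 (fun w : Cn n => ‖w‖ ^ 2) z := fun z =>
    (contDiff_norm_sq ℝ).contDiffAt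
  have hbdu : ∀ z ∈ frontier Ω, ∀ t ∈ Icc 0 τ, |u (z, t)| ≤ |Cφv| := by
    intro z hz t ht
    have ht' : t ∈ Ico 0 T := ⟨ht.1, ht.2.trans_lt hτ.2⟩
    rw [h.2.2.2.2.2.2.1 z hz t ht']
    exact ap_phi_bound hT h z (frontier_subset_closure hz) t ht'
  have h0u : ∀ z ∈ Ω, |u (z, 0)| ≤ |Cu| := fun z hz =>
    (h.2.2.2.2.2.2.2.1 z hz).trans (le_abs_self _)
  have hlog1 : ∀ z : Cn n, Real.log (cHess (fun w : Cn n => ‖w‖ ^ 2) z).det.re = 0 := by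
    intro z; rw [cHess_normsq]; simp
  have hCu := abs_nonneg Cu
  have hCp := abs_nonneg Cφv
  have up := comparison hΩo hΩb (τ := τ) (M := |Cu| + |Cφv|) hB u (fun p => ‖p.1‖ ^ 2)
    (ap_u_cont hΩb h hτ.2) hqc
    (fun z hz t ht => ap_u_C2 hΩo h hz (Ioc_sub hτ.2 ht)) (fun z _ t _ => hq2 z)
    (fun z hz t ht => ap_u_dt hΩo h hz (Ioc_sub hτ.2 ht)) (fun z _ t _ => by simp)
    (fun z hz t ht => h.2.2.2.2.1 t (Ioc_sub hτ.2 ht) z hz)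
    (by
      intro z hz
      have := (abs_le.1 (h0u z hz)).2
      have h2 : 0 ≤ ‖z‖ ^ 2 := by positivity
      simp only; linarith)
    (by
      intro z hz t ht
      have := (abs_le.1 (hbdu z hz t ht)).2
      have h2 : 0 ≤ ‖z‖ ^ 2 := by positivity
      simp only; linarith)
    (by
      intro z hz t ht _ hl
      simp only [hlog1] at hl
      rw [h.2.2.2.2.2.1 z hz t (Ioc_sub hτ.2 ht)]
      have := (abs_le.1 (ap_f_bound h hz (Ioc_sub hτ.2 ht) (u (z, t)))).2
      simp only [deriv_const]
      linarith) z hz τ ⟨hτ.1, le_rfl⟩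
  have dn := comparison hΩo hΩb (τ := τ) (M := |Cu| + |Cφv| + R) hB (fun p => ‖p.1‖ ^ 2) u
    hqc (ap_u_cont hΩb h hτ.2)
    (fun z _ t _ => hq2 z) (fun z hz t ht => ap_u_C2 hΩo h hz (Ioc_sub hτ.2 ht))
    (fun z _ t _ => by simp) (fun z hz t ht => ap_u_dt hΩo h hz (Ioc_sub hτ.2 ht))
    (fun z hz t ht => posDef_one_normsq z)
    (by
      intro z hz
      have := (abs_le.1 (h0u z hz)).1
      have h2 := hR z (subset_closure hz)
      simp only; linarith)
    (by
      intro z hz t ht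
      have := (abs_le.1 (hbdu z hz t ht)).1
      have h2 := hR z (frontier_subset_closure hz)
      simp only; linarith)
    (by
      intro z hz t ht _ hl
      simp only [hlog1] at hl
      rw [h.2.2.2.2.2.1 z hz t (Ioc_sub hτ.2 ht)]
      have := (abs_le.1 (ap_f_bound h hz (Ioc_sub hτ.2 ht) (u (z, t)))).1
      simp only [deriv_const]
      linarith) z hz τ ⟨hτ.1, le_rfl⟩
  have h3 : (|Cf| + 1) * τ ≤ (|Cf| + 1) * T := mul_le_mul_of_nonneg_left hτ.2.le hB
  have h4 := hR z hz
  have h5 : 0 ≤ ‖z‖ ^ 2 := by positivity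
  simp only at up dn
  rw [abs_le]
  constructor <;> linarith

/-- Comparison of `u` with its rescaling `v(z,t) = u(z,λt)/λ`. -/
theorem ap_scaling (hΩo : IsOpen Ω) (hΩb : IsBounded Ω) (hT : 0 < T) {C₁ : ℝ} (hC0 : 0 ≤ C₁)
    (h : AprioriHyps n Ω T Cu Cφv Cf u φ f)
    (hu : ∀ z ∈ closure Ω, ∀ t ∈ Ico 0 T, |u (z, t)| ≤ C₁)
    {τ l : ℝ} (hτ : 0 < τ) (hl : 1 < l) (hlτ : l * τ < T) :
    ∀ z ∈ Ω, |l⁻¹ * u (z, l * τ) - u (z, τ)| ≤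
      (l - 1) * (C₁ + |Cφv| * T + (n + |Cf| * T + 1) * T) := by
  intro z hz
  have hl0 : 0 < l := by linarith
  have hl1 : 0 < l - 1 := by linarith
  have hτT : τ < T := by nlinarith
  have hli : l⁻¹ * l = 1 := inv_mul_cancel₀ hl0.ne'
  have hli1 : l⁻¹ ≤ 1 := inv_le_one_of_one_le₀ hl.le
  have hli0 : 0 < l⁻¹ := inv_pos.2 hl0
  have hinv : 1 - l⁻¹ ≤ l - 1 := by nlinarith
  set v : Cn n × ℝ → ℝ := fun p => l⁻¹ * u (p.1, l * p.2) with hv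
  have hsc : ∀ t ∈ Icc 0 τ, l * t ∈ Icc 0 (l * τ) := fun t ht =>
    ⟨mul_nonneg hl0.le ht.1, mul_le_mul_of_nonneg_left ht.2 hl0.le⟩
  have hsc' : ∀ t ∈ Icc 0 τ, l * t ∈ Ico 0 T := fun t ht =>
    ⟨(hsc t ht).1, (hsc t ht).2.trans_lt hlτ⟩
  have hsco : ∀ t ∈ Ioc 0 τ, l * t ∈ Ioo 0 T := fun t ht =>
    ⟨mul_pos hl0 ht.1, (hsc t ⟨ht.1.le, ht.2⟩).2.trans_lt hlτ⟩
  have hid : ∀ t ∈ Icc 0 τ, t ∈ Ico 0 T := fun t ht => ⟨ht.1, ht.2.trans_lt hτT⟩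
  have huc := ap_u_cont hΩb h hτT
  have hvc : ContinuousOn v (closure Ω ×ˢ Icc 0 τ) := by
    have h1 : ContinuousOn (fun p : Cn n × ℝ => u (p.1, l * p.2)) (closure Ω ×ˢ Icc 0 τ) :=
      (ap_u_cont hΩb h hlτ).comp (f := fun p : Cn n × ℝ => (p.1, l * p.2)) (by fun_prop)
        (fun p hp => ⟨hp.1, hsc _ hp.2⟩)
    exact continuousOn_const.mul h1
  have hu2 : ∀ z ∈ Ω, ∀ t ∈ Ioc 0 τ, ContDiffAt ℝ 2 (fun w => u (w, t)) z :=
    fun z hz t ht => ap_u_C2 hΩo h hz (Ioc_sub hτT ht)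
  have hv2 : ∀ z ∈ Ω, ∀ t ∈ Ioc 0 τ, ContDiffAt ℝ 2 (fun w => v (w, t)) z :=
    fun z hz t ht => contDiffAt_const.mul (ap_u_C2 hΩo h hz (hsco t ht))
  have hut : ∀ z ∈ Ω, ∀ t ∈ Ioc 0 τ, DifferentiableAt ℝ (fun s => u (z, s)) t :=
    fun z hz t ht => ap_u_dt hΩo h hz (Ioc_sub hτT ht)
  have hvd : ∀ z ∈ Ω, ∀ t ∈ Ioc 0 τ,
      HasDerivAt (fun s => v (z, s)) (deriv (fun s => u (z, s)) (l * t)) t := by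
    intro z hz t ht
    have h1 := (ap_u_dt hΩo h hz (hsco t ht)).hasDerivAt
    have h2 : HasDerivAt (fun s : ℝ => l * s) l t := by
      simpa using! (hasDerivAt_id t).const_mul l
    have h3 := (h1.comp t h2).const_mul l⁻¹
    convert! h3 using 1
    rw [mul_comm _ l, ← mul_assoc, hli, one_mul]
  have hvt : ∀ z ∈ Ω, ∀ t ∈ Ioc 0 τ, DifferentiableAt ℝ (fun s => v (z, s)) t :=
    fun z hz t ht => (hvd z hz t ht).differentiableAt
  have hup : ∀ z ∈ Ω, ∀ t ∈ Ioc 0 τ, (cHess (fun w => u (w, t)) z).PosDef :=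
    fun z hz t ht => h.2.2.2.2.1 t (Ioc_sub hτT ht) z hz
  have hvH : ∀ z ∈ Ω, ∀ t ∈ Ioc 0 τ, cHess (fun w => v (w, t)) z =
      ((l⁻¹ : ℝ) : ℂ) • cHess (fun w => u (w, l * t)) z :=
    fun z hz t ht => cHess_const_mul l⁻¹ (ap_u_C2 hΩo h hz (hsco t ht))
  have hvp : ∀ z ∈ Ω, ∀ t ∈ Ioc 0 τ, (cHess (fun w => v (w, t)) z).PosDef := by
    intro z hz t ht
    rw [hvH z hz t ht]
    exact (h.2.2.2.2.1 _ (hsco t ht) z hz).smul (by exact_mod_cast hli0)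
  have hvlog : ∀ z ∈ Ω, ∀ t ∈ Ioc 0 τ, Real.log (cHess (fun w => v (w, t)) z).det.re =
      Real.log (cHess (fun w => u (w, l * t)) z).det.re - n * Real.log l := by
    intro z hz t ht
    have hpos : 0 < (cHess (fun w => u (w, l * t)) z).det.re := by
      have := (h.2.2.2.2.1 _ (hsco t ht) z hz).det_pos
      rw [Complex.lt_def] at this
      simpa using this.1
    rw [hvH z hz t ht, Matrix.det_smul, Fintype.card_fin, ← Complex.ofReal_pow,
      Complex.re_ofReal_mul, Real.log_mul (by positivity) hpos.ne', Real.log_pow, Real.log_inv]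
    ring
  have hlogl : Real.log l ≤ l - 1 := Real.log_le_sub_one_of_pos hl0
  have hlogl0 : 0 ≤ Real.log l := Real.log_nonneg hl.le
  have hnlog : (n : ℝ) * Real.log l ≤ n * (l - 1) :=
    mul_le_mul_of_nonneg_left hlogl (Nat.cast_nonneg n)
  have hnlog0 : 0 ≤ (n : ℝ) * Real.log l := mul_nonneg (Nat.cast_nonneg n) hlogl0
  have hCp := abs_nonneg Cφv
  have hCf := abs_nonneg Cf
  -- the initial and boundary estimates
  have hub : ∀ z ∈ closure Ω, ∀ t ∈ Icc 0 τ, |(1 - l⁻¹) * u (z, t)| ≤ (l - 1) * C₁ := by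
    intro z hz t ht
    rw [abs_mul, abs_of_nonneg (by linarith : 0 ≤ 1 - l⁻¹)]
    exact mul_le_mul hinv (hu z hz t (hid t ht)) (abs_nonneg _) hl1.le
  have hMle : (l - 1) * C₁ ≤ (l - 1) * (C₁ + |Cφv| * T) := by
    apply mul_le_mul_of_nonneg_left _ hl1.le
    have : 0 ≤ |Cφv| * T := by positivity
    linarith
  have hinit : ∀ z ∈ Ω, |v (z, 0) - u (z, 0)| ≤ (l - 1) * (C₁ + |Cφv| * T) := by
    intro z hz
    have h1 := hub z (subset_closure hz) 0 ⟨le_rfl, hτ.le⟩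
    have : v (z, 0) - u (z, 0) = -((1 - l⁻¹) * u (z, 0)) := by
      simp only [hv, mul_zero]; ring
    rw [this, abs_neg]
    exact h1.trans hMle
  have hbdry : ∀ z ∈ frontier Ω, ∀ t ∈ Icc 0 τ,
      |v (z, t) - u (z, t)| ≤ (l - 1) * (C₁ + |Cφv| * T) := by
    intro z hz t ht
    have hzc := frontier_subset_closure hz
    have h1 := hub z hzc t ht
    have h2 := ap_phi_lip hΩo hT h z hzc (l * t) (hsc' t ht) t (hid t ht)
    rw [← h.2.2.2.2.2.2.1 z hz _ (hsc' t ht), ← h.2.2.2.2.2.2.1 z hz _ (hid t ht)] at h2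
    have h3 : |l * t - t| ≤ (l - 1) * T := by
      have : l * t - t = (l - 1) * t := by ring
      rw [this, abs_of_nonneg (mul_nonneg hl1.le ht.1)]
      exact mul_le_mul_of_nonneg_left (hid t ht).2.le hl1.le
    have e : v (z, t) - u (z, t) =
        l⁻¹ * (u (z, l * t) - u (z, t)) - (1 - l⁻¹) * u (z, t) := by
      simp only [hv]; ring
    have h4 : |l⁻¹ * (u (z, l * t) - u (z, t))| ≤ |Cφv| * ((l - 1) * T) := by
      rw [abs_mul, abs_of_pos hli0]
      calc l⁻¹ * |u (z, l * t) - u (z, t)| ≤ 1 * |u (z, l * t) - u (z, t)| :=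
            mul_le_mul_of_nonneg_right hli1 (abs_nonneg _)
        _ ≤ |Cφv| * |l * t - t| := by rw [one_mul]; exact h2
        _ ≤ _ := mul_le_mul_of_nonneg_left h3 hCp
    rw [e]
    calc _ ≤ |l⁻¹ * (u (z, l * t) - u (z, t))| + |(1 - l⁻¹) * u (z, t)| := abs_sub _ _
      _ ≤ |Cφv| * ((l - 1) * T) + (l - 1) * C₁ := add_le_add h4 h1
      _ = _ := by ring
  -- facts at interior points
  have hlv : ∀ z ∈ Ω, ∀ t ∈ Ioc 0 τ, |u (z, l * t) - v (z, t)| ≤ (l - 1) * C₁ := by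
    intro z hz t ht
    have h1 := hu z (subset_closure hz) (l * t) (hsc' t ⟨ht.1.le, ht.2⟩)
    have e : u (z, l * t) - v (z, t) = (1 - l⁻¹) * u (z, l * t) := by
      simp only [hv]; ring
    rw [e, abs_mul, abs_of_nonneg (by linarith : 0 ≤ 1 - l⁻¹)]
    exact mul_le_mul hinv h1 (abs_nonneg _) hl1.le
  have hflip : ∀ z ∈ Ω, ∀ t ∈ Ioc 0 τ, ∀ r,
      |f (l * t, z, r) - f (t, z, r)| ≤ (l - 1) * (|Cf| * T) := by
    intro z hz t ht r
    have h1 := ap_f_lip hΩo h hz (hsco t ht) (Ioc_sub hτT ht) r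
    have e : l * t - t = (l - 1) * t := by ring
    rw [e, abs_of_nonneg (mul_nonneg hl1.le ht.1.le)] at h1
    have h2 : (l - 1) * t ≤ (l - 1) * T :=
      mul_le_mul_of_nonneg_left (ht.2.trans hτT.le) hl1.le
    calc _ ≤ _ := h1
      _ ≤ |Cf| * ((l - 1) * T) := mul_le_mul_of_nonneg_left h2 hCf
      _ = _ := by ring
  have hB : 0 ≤ (l - 1) * (n + |Cf| * T + 1) := by positivity
  have hBe : (l - 1) * (n + |Cf| * T + 1) = n * (l - 1) + (l - 1) * (|Cf| * T) + (l - 1) := by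
    ring
  have hn0 : 0 ≤ (n : ℝ) * (l - 1) := by positivity
  have up := comparison hΩo hΩb (τ := τ) (M := (l - 1) * (C₁ + |Cφv| * T)) hB v u hvc huc hv2 hu2
    hvt hut hvp (fun z hz => (abs_le.1 (hinit z hz)).2)
    (fun z hz t ht => (abs_le.1 (hbdry z hz t ht)).2)
    (by
      intro z hz t ht hM hL
      rw [(hvd z hz t ht).deriv, h.2.2.2.2.2.1 z hz _ (hsco t ht),
        h.2.2.2.2.2.1 z hz _ (Ioc_sub hτT ht)]
      rw [hvlog z hz t ht] at hL
      have h1 := (abs_le.1 (hlv z hz t ht)).1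
      have h2 : u (z, t) ≤ u (z, l * t) := by linarith
      have h3 := ap_f_anti hΩo h hz (hsco t ht) h2
      have h4 := (abs_le.1 (hflip z hz t ht (u (z, t)))).2
      simp only at h3
      linarith) z (subset_closure hz) τ ⟨hτ.le, le_rfl⟩
  have dn := comparison hΩo hΩb (τ := τ) (M := (l - 1) * (C₁ + |Cφv| * T)) hB u v huc hvc hu2 hv2
    hut hvt hup (fun z hz => by linarith [(abs_le.1 (hinit z hz)).1])
    (fun z hz t ht => by linarith [(abs_le.1 (hbdry z hz t ht)).1])
    (by
      intro z hz t ht hM hL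
      rw [(hvd z hz t ht).deriv, h.2.2.2.2.2.1 z hz _ (hsco t ht),
        h.2.2.2.2.2.1 z hz _ (Ioc_sub hτT ht)]
      rw [hvlog z hz t ht] at hL
      have h1 := (abs_le.1 (hlv z hz t ht)).2
      have h2 : u (z, l * t) ≤ u (z, t) := by linarith
      have h3 := ap_f_anti hΩo h hz (Ioc_sub hτT ht) h2
      have h4 := (abs_le.1 (hflip z hz t ht (u (z, l * t)))).1
      simp only at h3
      linarith) z (subset_closure hz) τ ⟨hτ.le, le_rfl⟩
  have h5 : (l - 1) * (n + |Cf| * T + 1) * τ ≤ (l - 1) * (n + |Cf| * T + 1) * T :=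
    mul_le_mul_of_nonneg_left hτT.le hB
  have h6 : (l - 1) * (C₁ + |Cφv| * T + (n + |Cf| * T + 1) * T) =
      (l - 1) * (C₁ + |Cφv| * T) + (l - 1) * (n + |Cf| * T + 1) * T := by ring
  have h7 : v (z, τ) = l⁻¹ * u (z, l * τ) := rfl
  rw [h6, ← h7, abs_le]
  constructor <;> linarith

theorem right_deriv_bound {g : ℝ → ℝ} {t C δ : ℝ} (hδ : t < δ) (hg : DifferentiableAt ℝ g t)
    (hm : ∀ s ∈ Ioo t δ, |g s - g t| ≤ C * (s - t)) : |deriv g t| ≤ C := by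
  have h1 := hg.hasDerivAt.tendsto_slope
  have h2 : Tendsto (slope g t) (𝓝[>] t) (𝓝 (deriv g t)) :=
    h1.mono_left (nhdsWithin_mono _ (fun x hx => ne_of_gt hx))
  refine le_of_tendsto h2.abs ?_
  filter_upwards [Ioo_mem_nhdsGT hδ] with s hs
  have hp : 0 < s - t := by linarith [hs.1]
  rw [slope_def_field, abs_div, abs_of_pos hp, div_le_iff₀ hp]
  exact hm s hs

end main

/-- **Bound on `t·u̇`** (Proposition 2.1): under the a priori hypotheses there is `C₂ > 0`
depending only on `Ω, T, Cu, Cφv, Cf` (through `T`, `Cf` and the uniform bound `C₁` on `|u|`)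
such that `t·|∂u/∂t| ≤ C₂` on `Ω×(0,T)`. -/
theorem stmt_7 (n : ℕ) (Ω : Set (Cn n)) (T Cu Cφv Cf : ℝ)
    (hΩ : IsSPCDomain Ω) (hT : 0 < T) :
    ∃ C₂ : ℝ, 0 < C₂ ∧
      ∀ (u φ : Cn n × ℝ → ℝ) (f : ℝ × Cn n × ℝ → ℝ),
        AprioriHyps n Ω T Cu Cφv Cf u φ f →
        ∀ z ∈ Ω, ∀ t ∈ Ioo (0 : ℝ) T, t * |deriv (fun s => u (z, s)) t| ≤ C₂ := by
  obtain ⟨hΩo, -, hΩb, -⟩ := hΩ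
  obtain ⟨r, hr⟩ := hΩb.closure.exists_norm_le
  have hR : ∀ z ∈ closure Ω, ‖z‖ ^ 2 ≤ r ^ 2 := fun z hz =>
    pow_le_pow_left₀ (norm_nonneg z) (hr z hz) 2
  set C₁ : ℝ := |Cu| + |Cφv| + r ^ 2 + (|Cf| + 1) * T with hC₁
  set D : ℝ := C₁ + |Cφv| * T + (n + |Cf| * T + 1) * T with hD
  have hC0 : 0 ≤ C₁ := by positivity
  have hD0 : 0 ≤ D := by positivity
  refine ⟨2 * D + C₁ + 1, by positivity, ?_⟩
  intro u φ f h z hz t ht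
  have hu := ap_u_bound hΩo hΩb hT (sq_nonneg r) hR h
  rw [← hC₁] at hu
  have hd := ap_u_dt hΩo h hz ht
  have ht0 : 0 < t := ht.1
  have key : |deriv (fun s => u (z, s)) t| ≤ (2 * D + C₁) / t := by
    refine right_deriv_bound (δ := min (2 * t) T) (lt_min (by linarith) ht.2) hd ?_
    intro s hs
    have hs1 : t < s := hs.1
    have hs2 : s < 2 * t := hs.2.trans_le (min_le_left _ _)
    have hs3 : s < T := hs.2.trans_le (min_le_right _ _)
    set l := s / t with hl
    have hlt : l * t = s := div_mul_cancel₀ s ht0.ne'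
    have hl1 : 1 < l := (one_lt_div ht0).2 hs1
    have hl2 : l < 2 := (div_lt_iff₀ ht0).2 hs2
    have h1 := ap_scaling hΩo hΩb hT hC0 h hu ht0 hl1 (by rw [hlt]; exact hs3) z hz
    rw [← hD, hlt] at h1
    have hl0 : 0 < l := by linarith
    have e : u (z, s) - u (z, t) = l * (l⁻¹ * u (z, s) - u (z, t)) + (l - 1) * u (z, t) := by
      field_simp
      ring
    have h2 := hu z (subset_closure hz) t ⟨ht0.le, ht.2⟩
    have e2 : (2 * D + C₁) / t * (s - t) = (l - 1) * (2 * D + C₁) := by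
      rw [hl]; field_simp
    have hlm : 0 < l - 1 := by linarith
    rw [e, e2]
    calc _ ≤ |l * (l⁻¹ * u (z, s) - u (z, t))| + |(l - 1) * u (z, t)| := abs_add_le _ _
      _ = l * |l⁻¹ * u (z, s) - u (z, t)| + (l - 1) * |u (z, t)| := by
        rw [abs_mul, abs_mul, abs_of_pos hl0, abs_of_pos hlm]
      _ ≤ 2 * ((l - 1) * D) + (l - 1) * C₁ := by
        refine add_le_add (mul_le_mul hl2.le h1 (abs_nonneg _) (by norm_num)) ?_
        exact mul_le_mul_of_nonneg_left h2 hlm.le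
      _ = _ := by ring
  calc t * |deriv (fun s => u (z, s)) t| ≤ t * ((2 * D + C₁) / t) :=
        mul_le_mul_of_nonneg_left key ht0.le
    _ = 2 * D + C₁ := by field_simp
    _ ≤ _ := by linarith
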